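/- Suppose t ≥ 2 and n ≥ ⌈t/2⌉, and let π be a QU-resolution falsity proof of the mod-3 formula Ψₙ from the axiom set H(Ψₙ, Π_t). Then the graph G(π) has at least 2^{n−⌈t/2⌉−1} sinks, and hence π has size at least 2^{n−⌈t/2⌉−1}. -/

import Mathlib

/-! Framework for quantified Boolean circuits (QBCs), QU-resolution,
relaxations, and the prover–delayer game, following Chen,
"Proof Complexity Modulo the Polynomial Hierarchy". -/

/-- Quantifiers. -/
inductive Quant where
  | all : Quant
  | ex : Quant
deriving DecidableEq

/-- A partial assignment of Boolean values to (numbered) propositional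
variables.  Via the correspondence `C ↔ assign(C)`, partial assignments also
represent clauses (the clause `clause(a)` is the unique clause with variable
set `dom a` falsified by `a`); we freely identify the two. -/
abbrev PA : Type := ℕ → Option Bool

/-- The everywhere-undefined partial assignment (= the empty clause). -/
def emptyPA : PA := fun _ => none

/-- `g` extends the partial assignment `f`. -/
def ExtendsPA (g f : PA) : Prop := ∀ v b, f v = some b → g v = some b

/-- A total assignment `g` extends a partial assignment `f`; when `f`
represents a clause, this says `g` falsifies that clause. -/
def TotalExtends (g : ℕ → Bool) (f : PA) : Prop := ∀ v b, f v = some b → g v = b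

/-- A partial assignment `r` satisfies a clause `C` (i.e. makes some literal
of `C` true). -/
def SatisfiedBy (r : PA) (C : PA) : Prop := ∃ v b, C v = some b ∧ r v = some (!b)

/-- A quantified Boolean circuit: a quantifier prefix (a list of
quantifier/variable pairs) together with a Boolean function on total
assignments, represented as a predicate. -/
structure QBC where
  pfx : List (Quant × ℕ)
  matrix : (ℕ → Bool) → Prop

/-- The variables of the prefix of a QBC. -/
def QBC.vars (Φ : QBC) : List ℕ := Φ.pfx.map Prod.snd

/-- Well-formedness of a QBC: the prefix has no repeated variables, and the
matrix depends only on the values of the prefix variables. -/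
def QBC.WellFormed (Φ : QBC) : Prop :=
  Φ.vars.Nodup ∧
  ∀ f g : ℕ → Bool, (∀ v ∈ Φ.vars, f v = g v) → (Φ.matrix f ↔ Φ.matrix g)

/-- Standard semantics of a quantifier prefix over a matrix, starting from a
base assignment. -/
def evalQ : List (Quant × ℕ) → ((ℕ → Bool) → Prop) → (ℕ → Bool) → Prop
  | [], φ, g => φ g
  | (Quant.ex, v) :: P, φ, g => ∃ b, evalQ P φ (Function.update g v b)
  | (Quant.all, v) :: P, φ, g => ∀ b, evalQ P φ (Function.update g v b)

/-- Truth of a QBC. -/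
def QBC.IsTrue (Φ : QBC) : Prop := ∀ g, evalQ Φ.pfx Φ.matrix g

/-- Falsity of a QBC. -/
def QBC.IsFalse (Φ : QBC) : Prop := ¬ Φ.IsTrue

/-- The existentially quantified variables of a prefix. -/
def existVars (P : List (Quant × ℕ)) : List ℕ :=
  (P.filter fun p => decide (p.1 = Quant.ex)).map Prod.snd

/-- The universally quantified variables of a prefix. -/
def univVars (P : List (Quant × ℕ)) : List ℕ :=
  (P.filter fun p => decide (p.1 = Quant.all)).map Prod.snd

/-- The relation `u ⪯ v` of a prefix: `vᵢ ⪯ vⱼ` iff `i ≤ j`, or `j < i` and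
`Qⱼ = Qⱼ₊₁ = ⋯ = Qᵢ`. -/
def preceq (P : List (Quant × ℕ)) (u v : ℕ) : Prop :=
  ∃ i j : ℕ, (P[i]?).map Prod.snd = some u ∧ (P[j]?).map Prod.snd = some v ∧
    (i ≤ j ∨ (j < i ∧ ∀ k, j ≤ k → k ≤ i → (P[k]?).map Prod.fst = (P[j]?).map Prod.fst))

/-- `u` strictly precedes `v` (`u ⪯ v` and not `v ⪯ u`). -/
def strictPrec (P : List (Quant × ℕ)) (u v : ℕ) : Prop :=
  preceq P u v ∧ ¬ preceq P v u

/-- dom(f) ⪯ y : every variable on which `f` is defined is `⪯ y`. -/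
def domPrec (P : List (Quant × ℕ)) (f : PA) (y : ℕ) : Prop :=
  ∀ u, f u ≠ none → preceq P u y

/-- An ∃-strategy: a family of response functions for the existential
variables, each depending only on the universal variables strictly
preceding it. -/
def IsExStrategy (Φ : QBC) (σ : ℕ → (ℕ → Bool) → Bool) : Prop :=
  ∀ x ∈ existVars Φ.pfx, ∀ τ τ' : ℕ → Bool,
    (∀ y ∈ univVars Φ.pfx, strictPrec Φ.pfx y x → τ y = τ' y) → σ x τ = σ x τ'

/-- The total assignment `⟨σ, τ⟩` induced by an ∃-strategy `σ` and an
assignment `τ` to the universal variables. -/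
def playE (Φ : QBC) (σ : ℕ → (ℕ → Bool) → Bool) (τ : ℕ → Bool) : ℕ → Bool :=
  fun v => if v ∈ existVars Φ.pfx then σ v τ else τ v

/-- `σ` is a winning ∃-strategy of the prefix of `Φ` for the matrix `M`. -/
def ModelOf (Φ : QBC) (M : (ℕ → Bool) → Prop) (σ : ℕ → (ℕ → Bool) → Bool) : Prop :=
  IsExStrategy Φ σ ∧ ∀ τ : ℕ → Bool, M (playE Φ σ τ)

/-- A model of `Φ` (a winning ∃-strategy). -/
def QBC.Model (Φ : QBC) (σ : ℕ → (ℕ → Bool) → Bool) : Prop :=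
  ModelOf Φ Φ.matrix σ

/-- `σ` is a model of `P : C`, where `P` is the prefix of `Φ` and `C` is a
clause (represented by its falsifying assignment). -/
def ModelOfClause (Φ : QBC) (σ : ℕ → (ℕ → Bool) → Bool) (C : PA) : Prop :=
  ModelOf Φ (fun g => ¬ TotalExtends g C) σ

/-- `C` is an axiom of `Φ`: a clause on the variables of `Φ` such that every
model of `Φ` is a model of `P : C`. -/
def IsAxiom (Φ : QBC) (C : PA) : Prop :=
  (∀ v, C v ≠ none → v ∈ Φ.vars) ∧ ∀ σ, Φ.Model σ → ModelOfClause Φ σ C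

/-- An axiom set of `Φ`. -/
def IsAxiomSet (Φ : QBC) (H : Set PA) : Prop := ∀ C ∈ H, IsAxiom Φ C

/-- A ∀-strategy: response functions for the universal variables, each
depending only on the existential variables strictly preceding it. -/
def IsUnivStrategy (Φ : QBC) (τ : ℕ → (ℕ → Bool) → Bool) : Prop :=
  ∀ y ∈ univVars Φ.pfx, ∀ σ σ' : ℕ → Bool,
    (∀ x ∈ existVars Φ.pfx, strictPrec Φ.pfx x y → σ x = σ' x) → τ y σ = τ y σ'

/-- The total assignment `⟨τ, σ⟩` induced by a ∀-strategy `τ` and an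
assignment `σ` to the existential variables. -/
def playU (Φ : QBC) (τ : ℕ → (ℕ → Bool) → Bool) (σ : ℕ → Bool) : ℕ → Bool :=
  fun v => if v ∈ univVars Φ.pfx then τ v σ else σ v

/-- A winning ∀-strategy: every play falsifies the matrix. -/
def WinningUnivStrategy (Φ : QBC) (τ : ℕ → (ℕ → Bool) → Bool) : Prop :=
  IsUnivStrategy Φ τ ∧ ∀ σ : ℕ → Bool, ¬ Φ.matrix (playU Φ τ σ)

/-- `C` is obtainable from `D` by ∀-elimination (relative to prefix `P`):
`C = D ∖ {L}` for a literal `L` on a universal variable `y` with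
`vars(C) ⪯ y`.  In assignment form: `D` is `C` additionally defined on `y`. -/
def ForallElim (P : List (Quant × ℕ)) (C D : PA) : Prop :=
  ∃ y b, y ∈ univVars P ∧ C y = none ∧ D = Function.update C y (some b) ∧
    ∀ u, C u ≠ none → preceq P u y

/-- `γ` is the resolvent of `α` and `β` on variable `v` (in falsifying
assignment form: `α` and `β` carry complementary literals on `v`, `γ` is
the union of the remainders, which must be a clause). -/
def IsResolvent (γ α β : PA) (v : ℕ) : Prop :=
  ∃ b, α v = some b ∧ β v = some (!b) ∧ γ v = none ∧
    (∀ u, u ≠ v → γ u = (α u).elim (β u) some) ∧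
    (∀ u, u ≠ v → ∀ b₁ b₂, α u = some b₁ → β u = some b₂ → b₁ = b₂)

/-- A step in a QU-resolution proof: an axiom, a ∀-elimination (annotated with
the index of its source), or a resolution step (annotated with the indices of
its two sources and the resolved variable). -/
inductive QUStep where
  | ax (C : PA)
  | elim (C : PA) (src : ℕ)
  | res (C : PA) (src₁ src₂ : ℕ) (v : ℕ)

/-- The clause of a proof step. -/
def QUStep.clause : QUStep → PA
  | .ax C => C
  | .elim C _ => C
  | .res C _ _ _ => C

/-- The clause at position `i` of a proof. -/
def stepClause? (L : List QUStep) (i : ℕ) : Option PA := (L[i]?).map QUStep.clause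

/-- Validity of the `i`-th step of a proof from axiom set `H`. -/
def validStep (P : List (Quant × ℕ)) (H : Set PA) (L : List QUStep) (i : ℕ) : Prop :=
  match L[i]? with
  | none => True
  | some (.ax C) => C ∈ H
  | some (.elim C j) => j < i ∧ ∃ D, stepClause? L j = some D ∧ ForallElim P C D
  | some (.res C j k v) => j < i ∧ k < i ∧
      ∃ α β, stepClause? L j = some α ∧ stepClause? L k = some β ∧ IsResolvent C α β v

/-- A QU-resolution proof of `Φ` from axiom set `H`. -/
def IsQUProof (Φ : QBC) (H : Set PA) (L : List QUStep) : Prop :=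
  ∀ i, validStep Φ.pfx H L i

/-- A QU-resolution falsity proof: a proof ending with the empty clause. -/
def IsFalsityProof (Φ : QBC) (H : Set PA) (L : List QUStep) : Prop :=
  IsQUProof Φ H L ∧ (L.getLast?).map QUStep.clause = some emptyPA

/-- The clause `C` appears in the proof `L`. -/
def AppearsIn (L : List QUStep) (C : PA) : Prop := ∃ i, stepClause? L i = some C

/-- The edge relation of the graph `G(π)`: an edge from each clause occurrence
to the clause occurrence(s) from which it is derived. -/
def edge (L : List QUStep) (i j : ℕ) : Prop :=
  match L[i]? with
  | some (.elim _ s) => j = s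
  | some (.res _ s t _) => j = s ∨ j = t
  | _ => False

/-- A sink (leaf) of `G(π)`: a vertex with no outgoing edges. -/
def isSink (L : List QUStep) (i : ℕ) : Prop := i < L.length ∧ ∀ j, ¬ edge L i j

/-- The proof is tree-like: `G(π)` is a tree (each vertex has at most one
incoming edge; acyclicity holds automatically since edges decrease indices). -/
def TreeLike (L : List QUStep) : Prop := ∀ j : ℕ, {i | edge L i j}.Subsingleton

-- The prefix `P[a]`: the variables of `dom a` are removed, and the
-- quantifier of every variable strictly preceding some variable of `dom a`
-- (equivalently, every `v` with `v ⪯ last(a)` and not `last(a) ⪯ v`) is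
-- changed to `∃`.
open Classical in
noncomputable def instPrefix (P : List (Quant × ℕ)) (a : PA) : List (Quant × ℕ) :=
  (P.filter fun p => (a p.2).isNone).map fun p =>
    (if ∃ u, a u ≠ none ∧ strictPrec P p.2 u then Quant.ex else p.1, p.2)

/-- Overriding a total assignment by a partial assignment. -/
def override (a : PA) (g : ℕ → Bool) : ℕ → Bool := fun v => (a v).getD (g v)

/-- The instantiated QBC `Φ[a]` = `P[a] : φ[a]`. -/
noncomputable def QBC.inst (Φ : QBC) (a : PA) : QBC :=
  ⟨instPrefix Φ.pfx a, fun g => Φ.matrix (override a g)⟩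

/-- `P'` is a relaxation of the prefix `P`: a permutation of `P` such that
`y ⪯ x` implies `y ⪯' x` for every universal `y` and existential `x`. -/
def IsRelaxationPfx (P P' : List (Quant × ℕ)) : Prop :=
  P.Perm P' ∧ ∀ y ∈ univVars P, ∀ x ∈ existVars P, preceq P y x → preceq P' y x

/-- `Φ'` is a relaxation of the QBC `Φ`. -/
def IsRelaxation (Φ Φ' : QBC) : Prop :=
  IsRelaxationPfx Φ.pfx Φ'.pfx ∧ Φ'.matrix = Φ.matrix

/-- Negation of a quantifier. -/
def Quant.neg : Quant → Quant
  | .all => .ex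
  | .ex => .all

/-- `isAltFrom q i qs`: the quantifier string `qs` consists of (at most) `i`
alternating possibly-empty blocks, starting with a block of `q`s. -/
def isAltFrom : Quant → ℕ → List Quant → Prop
  | _, 0, qs => qs = []
  | q, i + 1, qs => ∃ k rest, qs = List.replicate k q ++ rest ∧ isAltFrom q.neg i rest

/-- The prefix `P` is `Π_i`: its quantifier string lies in `∀*∃*∀*⋯` with `i`
alternating starred blocks beginning with `∀*`. -/
def isPiPrefix (i : ℕ) (P : List (Quant × ℕ)) : Prop :=
  isAltFrom Quant.all i (P.map Prod.fst)

/-- The axiom set `H(Φ, Π_k)`: the clauses `C` on variables of `Φ` such that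
some `Π_k`-relaxation of `Φ[assign(C)]` is false. -/
def Hset (Φ : QBC) (k : ℕ) : Set PA :=
  {C | (∀ v, C v ≠ none → v ∈ Φ.vars) ∧
    ∃ Φ' : QBC, IsRelaxation (Φ.inst C) Φ' ∧ isPiPrefix k Φ'.pfx ∧ Φ'.IsFalse}

/-- `g` is a semicompletion of `f` (relative to prefix `P`). -/
def SemiComp (P : List (Quant × ℕ)) (f g : PA) : Prop :=
  ExtendsPA g f ∧
  ∀ y ∈ univVars P, f y = none → domPrec P f y → (g y = none ∧ domPrec P g y)

/-- A set of partial assignments of `Φ` is semicompletion-closed. -/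
def SemiCompClosed (Φ : QBC) (H : Set PA) : Prop :=
  ∀ f ∈ H, ∀ g : PA, (∀ v, g v ≠ none → v ∈ Φ.vars) → SemiComp Φ.pfx f g → g ∈ H

/-- Delayer condition (semicompletion-of-empty). -/
def CondEmpty (Φ : QBC) (F : Set PA) (s : PA → ℕ) : Prop :=
  ∃ g ∈ F, SemiComp Φ.pfx emptyPA g ∧ s g = 0

/-- Delayer condition (monotonicity). -/
def CondMono (Φ : QBC) (F : Set PA) (s : PA → ℕ) : Prop :=
  ∀ g ∈ F, ∀ f' : PA, ExtendsPA g f' → ∃ f ∈ F, SemiComp Φ.pfx f' f ∧ s f ≤ s g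

/-- Delayer condition (∀-branching). -/
def CondForallB (Φ : QBC) (F : Set PA) (s : PA → ℕ) : Prop :=
  ∀ f ∈ F, ∀ y ∈ univVars Φ.pfx, f y = none → domPrec Φ.pfx f y →
    ∀ b : Bool, ∃ g ∈ F, SemiComp Φ.pfx (Function.update f y (some b)) g ∧ s g = s f

/-- Delayer condition (double-branching). -/
def CondDoubleB (Φ : QBC) (F : Set PA) (s : PA → ℕ) : Prop :=
  ∀ f ∈ F, ∀ v ∈ Φ.vars, f v = none →
    ∃ b : Bool, ∃ g ∈ F, SemiComp Φ.pfx (Function.update f v (some b)) g ∧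
      s g ≤ s f + 1 ∧
      (s g = s f + 1 →
        ∃ g' ∈ F, SemiComp Φ.pfx (Function.update f v (some (!b))) g' ∧ s g' ≤ s f + 1)

/-- A `p`-point delayer strategy for `Φ` with respect to axiom set `H`. -/
def IsDelayer (Φ : QBC) (H : Set PA) (p : ℕ) (F : Set PA) (s : PA → ℕ) : Prop :=
  (∀ f ∈ F, ∀ v, f v ≠ none → v ∈ Φ.vars) ∧
  CondEmpty Φ F s ∧ (∀ f ∈ F, f ∈ H → p ≤ s f) ∧
  CondMono Φ F s ∧ CondForallB Φ F s ∧ CondDoubleB Φ F s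

/-! The separation formulas `Φₙ` of Section 6. -/

/-- The variable `x_{i,j,k}`. -/
def xV (i : ℕ) (j k : Bool) : ℕ := 9 * i + 2 * cond j 1 0 + cond k 1 0

/-- The variable `x'_{i,j,k}`. -/
def xV' (i : ℕ) (j k : Bool) : ℕ := 9 * i + 4 + 2 * cond j 1 0 + cond k 1 0

/-- The variable `yᵢ`. -/
def yV (i : ℕ) : ℕ := 9 * i + 8

/-- A block of four quantified variables. -/
def blockOf (q : Quant) (f : Bool → Bool → ℕ) : List (Quant × ℕ) :=
  [(q, f false false), (q, f false true), (q, f true false), (q, f true true)]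

/-- The prefix `∃X₀ ∃X'₁∀y₁∃X₁ ⋯ ∃X'ₙ∀yₙ∃Xₙ`. -/
def sepPrefix (n : ℕ) : List (Quant × ℕ) :=
  blockOf Quant.ex (xV 0) ++
    (List.range n).flatMap fun i =>
      blockOf Quant.ex (xV' (i + 1)) ++ [(Quant.all, yV (i + 1))] ++
        blockOf Quant.ex (xV (i + 1))

/-- The clause `¬x_{0,j,k}` (as its falsifying assignment). -/
def clB1 (j k : Bool) : PA := fun v => if v = xV 0 j k then some true else none

/-- The clause `x_{n,j,0} ∨ x_{n,j,1}`. -/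
def clB2 (n : ℕ) (j : Bool) : PA :=
  fun v => if v = xV n j false ∨ v = xV n j true then some false else none

/-- The clause `¬x'_{i,0,k} ∨ ¬x'_{i,1,l} ∨ x_{i−1,j,0} ∨ x_{i−1,j,1}`. -/
def clH (i : ℕ) (j k l : Bool) : PA := fun v =>
  if v = xV' i false k ∨ v = xV' i true l then some true
  else if v = xV (i - 1) j false ∨ v = xV (i - 1) j true then some false
  else none

/-- For `j = false` the clause `¬x_{i,0,k} ∨ yᵢ ∨ x'_{i,0,k}`; for `j = true`
the clause `¬x_{i,1,k} ∨ ¬yᵢ ∨ x'_{i,1,k}`. -/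
def clT (i : ℕ) (j k : Bool) : PA := fun v =>
  if v = xV i j k then some true
  else if v = yV i then some j
  else if v = xV' i j k then some false
  else none

/-- The set `Tᵢ` of clauses. -/
def Tset (i : ℕ) : Set PA := {C | ∃ j k : Bool, C = clT i j k}

/-- The set of clauses of the matrix `φₙ`. -/
def sepClauses (n : ℕ) : Set PA :=
  {C | (∃ j k : Bool, C = clB1 j k) ∨ (∃ j : Bool, C = clB2 n j) ∨
    (∃ i, 1 ≤ i ∧ i ≤ n ∧ ∃ j k l : Bool, C = clH i j k l) ∨
    (∃ i, 1 ≤ i ∧ i ≤ n ∧ ∃ j k : Bool, C = clT i j k)}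

/-- The separation formula `Φₙ`. -/
def sepQBC (n : ℕ) : QBC :=
  ⟨sepPrefix n, fun g => ∀ C ∈ sepClauses n, ¬ TotalExtends g C⟩

/-- The level-`i` variables `X'ᵢ ∪ {yᵢ} ∪ Xᵢ`. -/
def levelVars (i : ℕ) : List ℕ :=
  [xV' i false false, xV' i false true, xV' i true false, xV' i true true, yV i,
   xV i false false, xV i false true, xV i true false, xV i true true]

/-- `r` is defined exactly on the level-`i` variables. -/
def OnLevel (i : ℕ) (r : PA) : Prop := ∀ v, r v ≠ none ↔ v ∈ levelVars i

/-- A normal realization of level `i`. -/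
def NormalReal (i : ℕ) (r : PA) : Prop :=
  OnLevel i r ∧ ∃ b : Bool, r (yV i) = some b ∧
    r (xV i b false) = some false ∧ r (xV' i b false) = some false ∧
    r (xV i b true) = some false ∧ r (xV' i b true) = some false ∧
    ∃ c : Bool, r (xV i (!b) false) = some c ∧ r (xV' i (!b) false) = some c ∧
      r (xV i (!b) true) = some (!c) ∧ r (xV' i (!b) true) = some (!c)

/-- A funny realization of level `i`. -/
def FunnyReal (i : ℕ) (r : PA) : Prop :=
  OnLevel i r ∧ ∃ b : Bool, r (yV i) = some b ∧
    (∃ c : Bool, r (xV i b false) = some c ∧ r (xV' i b false) = some c ∧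
      r (xV i b true) = some (!c) ∧ r (xV' i b true) = some (!c)) ∧
    r (xV' i (!b) false) = some false ∧ r (xV' i (!b) true) = some false ∧
    ∃ d : Bool, r (xV i (!b) false) = some d ∧ r (xV i (!b) true) = some (!d)

/-- Restriction of a partial assignment to the level-`i` variables. -/
def restrictLevel (i : ℕ) (f : PA) : PA :=
  fun v => if v ∈ levelVars i then f v else none

-- The maximum level `ℓ` containing an existentially quantified variable of
-- `dom f` (and `0` if there is none).
open Classical in
noncomputable def maxLevel (n : ℕ) (f : PA) : ℕ :=
  ((Finset.Icc 1 n).filter fun i => ∃ v ∈ levelVars i, v ≠ yV i ∧ f v ≠ none).sup id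

/-- `f` is half-defined on level `ℓ`. -/
def HalfDefined (ℓ : ℕ) (f : PA) : Prop :=
  (∀ j k : Bool, f (xV ℓ j k) = none) ∧
  (∃ j k : Bool, f (xV' ℓ j k) = some true ∧
    ∀ j' k' : Bool, (j', k') ≠ (j, k) → f (xV' ℓ j' k') = some false)

/-- A normal assignment of `Φₙ`. -/
def NormalAssign (n : ℕ) (f : PA) : Prop :=
  (∀ v, f v ≠ none → v ∈ (sepPrefix n).map Prod.snd) ∧
  (∀ j k : Bool, f (xV 0 j k) = some false) ∧
  (∀ i, 1 ≤ i → i + 1 ≤ maxLevel n f → NormalReal i (restrictLevel i f)) ∧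
  (1 ≤ maxLevel n f →
    (NormalReal (maxLevel n f) (restrictLevel (maxLevel n f) f) ∨
      HalfDefined (maxLevel n f) f))

/-- A funny assignment of `Φₙ`, with witness `m` (so that `sₙ(f) = m`). -/
def FunnyAssign (n : ℕ) (f : PA) (m : ℕ) : Prop :=
  (∀ v, f v ≠ none → v ∈ (sepPrefix n).map Prod.snd) ∧
  1 ≤ m ∧ m ≤ maxLevel n f ∧
  (∀ j k : Bool, f (xV 0 j k) = some false) ∧
  (∀ i, 1 ≤ i → i < m → NormalReal i (restrictLevel i f)) ∧
  FunnyReal m (restrictLevel m f) ∧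
  (∀ i, m < i → i ≤ maxLevel n f → ∀ j : Bool,
    ((f (xV i j false) ≠ none ∨ f (xV i j true) ≠ none ∨
      f (xV' i j false) ≠ none ∨ f (xV' i j true) ≠ none) →
      ∃ c : Bool, f (xV i j false) = some c ∧ f (xV' i j false) = some c ∧
        f (xV i j true) = some (!c) ∧ f (xV' i j true) = some (!c)))

/-- The set `Fₙ` of normal and funny assignments. -/
def Fset (n : ℕ) : Set PA := {f | NormalAssign n f ∨ ∃ m, FunnyAssign n f m}

-- The score function `sₙ`.
open Classical in
noncomputable def score (n : ℕ) (f : PA) : ℕ :=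
  if h : ∃ m, FunnyAssign n f m then h.choose else maxLevel n f

/-! The mod-3 formulas `Ψₙ` of Section 7 (variables `xᵢ = 2i`, `yᵢ = 2i+1`). -/

/-- The prefix `∃x₁∀y₁⋯∃xₙ∀yₙ`. -/
def modPrefix (n : ℕ) : List (Quant × ℕ) :=
  (List.range n).flatMap fun i =>
    [(Quant.ex, 2 * (i + 1)), (Quant.all, 2 * (i + 1) + 1)]

/-- Numeric value of a Boolean. -/
def boolVal (b : Bool) : ℕ := cond b 1 0

/-- The matrix `φ_{n,j}`: true iff `j + Σᵢ (xᵢ + yᵢ) ≢ n (mod 3)`. -/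
def modMatrix (n j : ℕ) (g : ℕ → Bool) : Prop :=
  ¬ ((j + ∑ i ∈ Finset.Icc 1 n, (boolVal (g (2 * i)) + boolVal (g (2 * i + 1)))) % 3
      = n % 3)

/-- The mod-3 formula `Ψₙ`. -/
def modQBC (n : ℕ) : QBC := ⟨modPrefix n, modMatrix n 0⟩

/-! ### The prefix of the mod-3 formula -/

theorem modPrefix_eq (n : ℕ) : modPrefix n =
    (List.range (2 * n)).map fun p => (if p % 2 = 0 then Quant.ex else Quant.all, p + 2) := by
  induction n with
  | zero => simp [modPrefix]
  | succ k ih =>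
    have h : 2 * (k + 1) = 2 * k + 1 + 1 := by ring
    have e : modPrefix (k + 1) = modPrefix k ++
        [(Quant.ex, 2 * (k + 1)), (Quant.all, 2 * (k + 1) + 1)] := by
      simp [modPrefix, List.range_succ]
    rw [e, ih, h, List.range_succ, List.range_succ]
    have h1 : (2 * k + 1) % 2 = 1 := by omega
    simp [h1]

theorem modPrefix_get (n p : ℕ) (hp : p < 2 * n) : (modPrefix n)[p]? =
    some (if p % 2 = 0 then Quant.ex else Quant.all, p + 2) := by
  rw [modPrefix_eq]; simp [hp]

theorem modPrefix_get_none (n p : ℕ) (hp : ¬ p < 2 * n) : (modPrefix n)[p]? = none := by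
  rw [modPrefix_eq]; simp; omega

theorem mem_modPrefix (n : ℕ) (q : Quant) (v : ℕ) : (q, v) ∈ modPrefix n ↔
    2 ≤ v ∧ v ≤ 2 * n + 1 ∧ q = if v % 2 = 0 then Quant.ex else Quant.all := by
  rw [modPrefix_eq]
  simp only [List.mem_map, List.mem_range, Prod.mk.injEq]
  constructor
  · rintro ⟨p, hp, rfl, rfl⟩
    refine ⟨by omega, by omega, by simp⟩
  · rintro ⟨h1, h2, rfl⟩
    refine ⟨v - 2, by omega, ?_, by omega⟩
    have : (v - 2) % 2 = v % 2 := by omega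
    rw [this]

theorem preceq_mod (n u v : ℕ) : preceq (modPrefix n) u v ↔ 2 ≤ u ∧ u ≤ v ∧ v ≤ 2 * n + 1 := by
  constructor
  · rintro ⟨i, j, hi, hj, h⟩
    by_cases hi' : i < 2 * n
    swap
    · rw [modPrefix_get_none n i hi'] at hi; simp at hi
    by_cases hj' : j < 2 * n
    swap
    · rw [modPrefix_get_none n j hj'] at hj; simp at hj
    rw [modPrefix_get n i hi'] at hi
    rw [modPrefix_get n j hj'] at hj
    simp at hi hj
    rcases h with h | ⟨h1, h2⟩
    · omega
    · have := h2 (j + 1) (by omega) (by omega)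
      rw [modPrefix_get n j hj', modPrefix_get n (j + 1) (by omega)] at this
      rcases Nat.mod_two_eq_zero_or_one j with h0 | h0
      · have h3 : (j + 1) % 2 = 1 := by omega
        simp [h0, h3] at this
      · have h3 : (j + 1) % 2 = 0 := by omega
        simp [h0, h3] at this
  · rintro ⟨h1, h2, h3⟩
    refine ⟨u - 2, v - 2, ?_, ?_, Or.inl (by omega)⟩
    · rw [modPrefix_get n _ (by omega)]; simp; omega
    · rw [modPrefix_get n _ (by omega)]; simp; omega

theorem strictPrec_mod (n u v : ℕ) : strictPrec (modPrefix n) u v ↔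
    2 ≤ u ∧ u < v ∧ v ≤ 2 * n + 1 := by
  unfold strictPrec
  rw [preceq_mod, preceq_mod]; omega

theorem mem_modVars (n v : ℕ) : v ∈ (modQBC n).vars ↔ 2 ≤ v ∧ v ≤ 2 * n + 1 := by
  simp only [QBC.vars, modQBC, List.mem_map, Prod.exists, exists_eq_right, mem_modPrefix]
  constructor
  · rintro ⟨q, h1, h2, -⟩; exact ⟨h1, h2⟩
  · rintro ⟨h1, h2⟩; exact ⟨_, h1, h2, rfl⟩

theorem mem_univVars (P : List (Quant × ℕ)) (v : ℕ) : v ∈ univVars P ↔ (Quant.all, v) ∈ P := by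
  simp only [univVars, List.mem_map, List.mem_filter, Prod.exists, exists_eq_right,
    decide_eq_true_eq]

theorem mem_existVars (P : List (Quant × ℕ)) (v : ℕ) : v ∈ existVars P ↔ (Quant.ex, v) ∈ P := by
  simp only [existVars, List.mem_map, List.mem_filter, Prod.exists, exists_eq_right,
    decide_eq_true_eq]

theorem vars_pairwise (n : ℕ) : ((modPrefix n).map Prod.snd).Pairwise (· < ·) := by
  rw [modPrefix_eq, List.map_map, List.pairwise_map]
  exact (List.pairwise_lt_range).imp (by intro a b h; simpa using h)

theorem inst_vars (P : List (Quant × ℕ)) (a : PA) : (instPrefix P a).map Prod.snd =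
    (P.map Prod.snd).filter fun v => (a v).isNone := by
  unfold instPrefix
  rw [List.map_map, List.filter_map]
  rfl

theorem inst_pairwise (n : ℕ) (a : PA) :
    ((instPrefix (modPrefix n) a).map Prod.snd).Pairwise (· < ·) := by
  rw [inst_vars]; exact (vars_pairwise n).filter _

theorem mem_inst (n : ℕ) (a : PA) (q : Quant) (v : ℕ) (ha : ∀ v, a v ≠ none → v ≤ 2 * n + 1) :
    (q, v) ∈ instPrefix (modPrefix n) a ↔
    2 ≤ v ∧ v ≤ 2 * n + 1 ∧ a v = none ∧
      ((q = Quant.all ∧ v % 2 = 1 ∧ ∀ u, v < u → a u = none) ∨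
       (q = Quant.ex ∧ (v % 2 = 0 ∨ ∃ u, v < u ∧ a u ≠ none))) := by
  classical
  unfold instPrefix
  simp only [List.mem_map, List.mem_filter, Prod.exists, Option.isNone_iff_eq_none, Prod.mk.injEq,
    strictPrec_mod, mem_modPrefix]
  constructor
  · rintro ⟨q', v', ⟨⟨h1, h2, h3⟩, h4⟩, h5, rfl⟩
    refine ⟨h1, h2, h4, ?_⟩
    by_cases hex : ∃ u, a u ≠ none ∧ 2 ≤ v' ∧ v' < u ∧ u ≤ 2 * n + 1
    · rw [if_pos hex] at h5
      obtain ⟨u, hu1, -, hu2, -⟩ := hex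
      exact Or.inr ⟨h5.symm, Or.inr ⟨u, hu2, hu1⟩⟩
    · rw [if_neg hex] at h5
      rcases Nat.mod_two_eq_zero_or_one v' with h0 | h0
      · rw [h0] at h3; right; refine ⟨by rw [← h5, h3]; simp, Or.inl h0⟩
      · rw [h0] at h3; left; refine ⟨by rw [← h5, h3]; simp, h0, ?_⟩
        intro u hu
        by_contra hne
        exact hex ⟨u, hne, h1, hu, ha u hne⟩
  · rintro ⟨h1, h2, h3, h4⟩
    refine ⟨_, v, ⟨⟨h1, h2, rfl⟩, h3⟩, ?_, rfl⟩
    rcases h4 with ⟨rfl, h5, h6⟩ | ⟨rfl, h5⟩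
    · rw [if_neg, h5]
      · simp
      · rintro ⟨u, hu1, -, hu2, -⟩; exact hu1 (h6 u hu2)
    · split_ifs with h7 h8
      · rfl
      · rfl
      · rcases h5 with h5 | ⟨u, hu1, hu2⟩
        · exact absurd h5 h8
        · exact absurd ⟨u, hu2, h1, hu1, ha u hu2⟩ h7

/-! ### The mod-3 counting game -/

/-- Residues from which the universal player wins. -/
def winSet : List Quant → ZMod 3 → Bool
  | [] => fun r => decide (r = 0)
  | Quant.ex :: q => fun r => winSet q r && winSet q (r + 1)
  | Quant.all :: q => fun r => winSet q r || winSet q (r + 1)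

/-- Value of a Boolean mod 3. -/
def b3 (b : Bool) : ZMod 3 := cond b 1 0

theorem evalQ_iff (Q : List (Quant × ℕ)) : ∀ (φ : (ℕ → Bool) → Prop) (g : ℕ → Bool) (r : ZMod 3),
    (Q.map Prod.snd).Nodup →
    (∀ g', (∀ v, v ∉ Q.map Prod.snd → g' v = g v) →
      (φ g' ↔ r + ((Q.map Prod.snd).map fun v => b3 (g' v)).sum ≠ 0)) →
    (evalQ Q φ g ↔ winSet (Q.map Prod.fst) r = false) := by
  induction Q with
  | nil =>
    intro φ g r _ h
    have := h g (by simp)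
    simp [evalQ, winSet, this]
  | cons p Q ih =>
    obtain ⟨q, v⟩ := p
    intro φ g r hnd h
    simp only [List.map_cons, List.nodup_cons] at hnd
    have key : ∀ b, evalQ Q φ (Function.update g v b) ↔
        winSet (Q.map Prod.fst) (r + b3 b) = false := by
      intro b
      apply ih φ _ _ hnd.2
      intro g' hg'
      rw [h g']
      · have : g' v = b := by rw [hg' v hnd.1]; simp
        simp [this, add_assoc]
      · intro w hw
        simp only [List.map_cons, List.mem_cons, not_or] at hw
        rw [hg' w hw.2, Function.update_of_ne hw.1]
    cases q
    · simp only [evalQ, List.map_cons, winSet, Bool.forall_bool, key]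
      simp [b3]
    · simp only [evalQ, List.map_cons, winSet, Bool.exists_bool, key]
      simp only [b3, cond_true, cond_false, add_zero, Bool.and_eq_false_iff]

theorem card_all : ∀ w : ZMod 3 → Bool, (Finset.univ.filter fun r => w r = true).card = 1 →
    (Finset.univ.filter fun r => (w r || w (r + 1)) = true).card = 2 := by decide

theorem card_ex1 : ∀ w : ZMod 3 → Bool, (Finset.univ.filter fun r => w r = true).card = 1 →
    ∀ r, (w r && w (r + 1)) = false := by decide

theorem card_ex2 : ∀ w : ZMod 3 → Bool, (Finset.univ.filter fun r => w r = true).card = 2 →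
    (Finset.univ.filter fun r => (w r && w (r + 1)) = true).card = 1 := by decide

theorem winSet_or (q : List Quant)
    (h : ∀ s, s <:+ q → s.count Quant.all ≤ s.count Quant.ex + 1) :
    (∀ r, winSet q r = false) ∨
    ((∀ s, s <:+ q → s.count Quant.ex ≤ s.count Quant.all) ∧
      (Finset.univ.filter fun r => winSet q r = true).card + q.count Quant.ex
        = 1 + q.count Quant.all) := by
  induction q with
  | nil =>
    right
    refine ⟨?_, ?_⟩
    · intro s hs; simp at hs; simp [hs]
    · decide
  | cons a q ih =>
    have h0 := h (a :: q) (List.suffix_refl _)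
    have h1 := h q (List.suffix_cons _ _)
    rcases ih (fun s hs => h s (hs.trans (List.suffix_cons _ _))) with h2 | ⟨h2, h3⟩
    · left
      intro r
      cases a <;> simp [winSet, h2]
    · have h4 := h2 q (List.suffix_refl _)
      cases a with
      | all =>
        simp at h0
        right
        have hc : (Finset.univ.filter fun r => winSet q r = true).card = 1 := by omega
        have hc' := card_all _ hc
        refine ⟨?_, ?_⟩
        · intro s hs
          rcases List.suffix_cons_iff.1 hs with rfl | hs
          · simp; omega
          · exact h2 s hs
        · have hc2 : (Finset.univ.filter fun r => winSet (Quant.all :: q) r = true).card = 2 := hc'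
          rw [hc2]; simp; omega
      | ex =>
        by_cases h5 : q.count Quant.ex = q.count Quant.all
        · left
          have hc : (Finset.univ.filter fun r => winSet q r = true).card = 1 := by omega
          exact card_ex1 _ hc
        · right
          have hc : (Finset.univ.filter fun r => winSet q r = true).card = 2 := by omega
          have hc' := card_ex2 _ hc
          refine ⟨?_, ?_⟩
          · intro s hs
            rcases List.suffix_cons_iff.1 hs with rfl | hs
            · simp; omega
            · exact h2 s hs
          · have hc2 : (Finset.univ.filter fun r => winSet (Quant.ex :: q) r = true).card = 1 := hc'
            rw [hc2]; simp; omega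

theorem alt_length (i : ℕ) : ∀ (a : Quant) (q : List Quant),
    (∀ s, s <:+ q → s.count Quant.all ≤ s.count Quant.ex + 1) →
    (∀ s, s <:+ q → s.count Quant.ex ≤ s.count Quant.all) →
    isAltFrom a i q → q.length ≤ i := by
  induction i with
  | zero => intro a q _ _ h; simp only [isAltFrom] at h; simp [h]
  | succ i ih =>
    rintro a q h1 h2 ⟨k, rest, rfl, h3⟩
    have hr : rest <:+ List.replicate k a ++ rest := List.suffix_append _ _
    have := ih _ rest (fun s hs => h1 s (hs.trans hr)) (fun s hs => h2 s (hs.trans hr)) h3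
    have e1 := h1 _ hr
    have e2 := h2 _ hr
    have e3 := h1 _ (List.suffix_refl _)
    have e4 := h2 _ (List.suffix_refl _)
    simp only [List.count_append, List.count_replicate] at e3 e4
    have : k ≤ 1 := by
      cases a
      · simp at e3 e4; omega
      · simp at e3 e4; omega
    simp; omega

/-! ### Axioms miss at most one early variable -/

theorem count_eq_card (Q : List (Quant × ℕ)) (q : Quant) (hQ : (Q.map Prod.snd).Nodup) :
    (Q.map Prod.fst).count q =
      (((Q.filter fun p => decide (p.1 = q)).map Prod.snd).toFinset).card := by
  rw [List.toFinset_card_of_nodup]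
  · rw [List.length_map, ← List.countP_eq_length_filter, List.count, List.countP_map]
    apply List.countP_congr
    intro x _; simp
  · exact hQ.sublist ((List.filter_sublist (l := Q)).map _)

theorem sum_pairs (n : ℕ) (f : ℕ → ℕ) :
    ∑ i ∈ Finset.Icc 1 n, (f (2 * i) + f (2 * i + 1)) = ∑ v ∈ Finset.Icc 2 (2 * n + 1), f v := by
  induction n with
  | zero => simp
  | succ k ih =>
    rw [Finset.sum_Icc_succ_top (by omega), ih]
    have : 2 * (k + 1) + 1 = 2 * k + 1 + 1 + 1 := by ring
    rw [this, Finset.sum_Icc_succ_top (b := 2 * k + 1 + 1) (by omega),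
      Finset.sum_Icc_succ_top (b := 2 * k + 1) (by omega)]
    ring_nf

theorem b3_cast (b : Bool) : b3 b = ((boolVal b : ℕ) : ZMod 3) := by cases b <;> rfl

theorem missing_contra (n t : ℕ) (hn : (t + 1) / 2 ≤ n) (C : PA) (hC : C ∈ Hset (modQBC n) t)
    (u w : ℕ) (hu : 2 ≤ u) (huw : u < w) (hw : w ≤ 2 * (n - (t + 1) / 2))
    (hCu : C u = none) (hCw : C w = none) : False := by
  classical
  obtain ⟨hdom, Φ', ⟨⟨hperm, hrel⟩, hmat⟩, hpi, hfalse⟩ := hC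
  have hle : ∀ v, C v ≠ none → v ≤ 2 * n + 1 := fun v hv => ((mem_modVars n v).1 (hdom v hv)).2
  have hge : ∀ v, C v ≠ none → 2 ≤ v := fun v hv => ((mem_modVars n v).1 (hdom v hv)).1
  set P := instPrefix (modPrefix n) C with hP
  have hperm : P.Perm Φ'.pfx := hperm
  have hrel : ∀ y ∈ univVars P, ∀ x ∈ existVars P, preceq P y x → preceq Φ'.pfx y x := hrel
  have hmem : ∀ q v, (q, v) ∈ Φ'.pfx ↔ 2 ≤ v ∧ v ≤ 2 * n + 1 ∧ C v = none ∧
      ((q = Quant.all ∧ v % 2 = 1 ∧ ∀ u, v < u → C u = none) ∨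
       (q = Quant.ex ∧ (v % 2 = 0 ∨ ∃ u, v < u ∧ C u ≠ none))) := by
    intro q v
    rw [← hperm.mem_iff, hP, mem_inst n C q v hle]
  have hndP : (P.map Prod.snd).Nodup := (inst_pairwise n C).imp (fun h => ne_of_lt h)
  have hnd : (Φ'.pfx.map Prod.snd).Nodup := (hperm.map _).nodup_iff.1 hndP
  -- the key order property
  have hkey : ∀ Q, Q <:+ Φ'.pfx → ∀ y, (Quant.all, y) ∈ Q → y ≠ 2 * n + 1 →
      (Quant.ex, y + 1) ∈ Q := by
    intro Q hQ y hy hyn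
    have hyP' := hQ.subset hy
    have hyy := (hmem _ _).1 hyP'
    simp at hyy
    obtain ⟨y1, y2, y3, y4, y5⟩ := hyy
    have hxP' : (Quant.ex, y + 1) ∈ Φ'.pfx := by
      rw [hmem]
      exact ⟨by omega, by omega, y5 _ (by omega), Or.inr ⟨rfl, Or.inl (by omega)⟩⟩
    have hyP := hperm.mem_iff.2 hyP'
    have hxP := hperm.mem_iff.2 hxP'
    have hpre : preceq P y (y + 1) := by
      obtain ⟨i, hi, hi'⟩ := List.getElem_of_mem hyP
      obtain ⟨j, hj, hj'⟩ := List.getElem_of_mem hxP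
      refine ⟨i, j, by simp [hi, hi'], by simp [hj, hj'], Or.inl ?_⟩
      by_contra hlt
      have := List.pairwise_iff_getElem.1 (inst_pairwise n C) j i (by simpa using hj)
        (by simpa using hi) (by omega)
      simp only [List.getElem_map] at this
      change P[j].2 < P[i].2 at this
      rw [hi', hj'] at this
      simp at this
    obtain ⟨i, j, hi, hj, hij⟩ := hrel y ((mem_univVars _ _).2 hyP) (y + 1)
      ((mem_existVars _ _).2 hxP) hpre
    simp only [Option.map_eq_some_iff, Prod.exists, exists_eq_right] at hi hj
    obtain ⟨qi, hi⟩ := hi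
    obtain ⟨qj, hj⟩ := hj
    have hqi : qi = Quant.all := by
      have := (hmem _ _).1 (List.mem_of_getElem? hi)
      rcases this with ⟨-, -, -, h | h⟩
      · exact h.1
      · rcases h.2 with h | ⟨u, hu1, hu2⟩
        · omega
        · exact absurd (y5 u hu1) hu2
    have hqj : qj = Quant.ex := by
      have := (hmem _ _).1 (List.mem_of_getElem? hj)
      rcases this with ⟨-, -, -, h | h⟩
      · omega
      · exact h.1
    subst hqi hqj
    have hlt : i < j := by
      rcases hij with h | ⟨h1, h2⟩
      · rcases h.lt_or_eq with h | h
        · exact h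
        · subst h; rw [hi] at hj; simp at hj
      · have := h2 i (by omega) le_rfl
        rw [hi, hj] at this; simp at this
    obtain ⟨pre, hpre'⟩ := hQ
    rw [← hpre'] at hi hj hnd
    rw [List.map_append] at hnd
    have hnm : (Quant.all, y) ∉ pre := by
      intro hh
      exact (List.disjoint_of_nodup_append hnd)
        (List.mem_map_of_mem (f := Prod.snd) hh) (List.mem_map_of_mem (f := Prod.snd) hy)
    have hilen : pre.length ≤ i := by
      by_contra hh
      rw [List.getElem?_append_left (by omega)] at hi
      exact hnm (List.mem_of_getElem? hi)
    rw [List.getElem?_append_right (by omega)] at hj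
    exact List.mem_of_getElem? hj
  have hsufnd : ∀ Q, Q <:+ Φ'.pfx → (Q.map Prod.snd).Nodup := fun Q hQ =>
    hnd.sublist (hQ.sublist.map _)
  have hfs : ∀ (Q : List (Quant × ℕ)) q v,
      v ∈ ((Q.filter fun p => decide (p.1 = q)).map Prod.snd).toFinset ↔ (q, v) ∈ Q := by
    intro Q q v
    simp only [List.mem_toFinset, List.mem_map, List.mem_filter, Prod.exists, exists_eq_right,
      decide_eq_true_eq]
  have hsuf : ∀ s, s <:+ Φ'.pfx.map Prod.fst → s.count Quant.all ≤ s.count Quant.ex + 1 := by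
    intro s hs
    obtain ⟨Q, hQ, rfl⟩ : ∃ Q, Q <:+ Φ'.pfx ∧ Q.map Prod.fst = s := by
      obtain ⟨pre, hpre⟩ := hs
      obtain ⟨l1, l2, h1, h2, h3⟩ := List.map_eq_append_iff.1 hpre.symm
      exact ⟨l2, ⟨l1, h1.symm⟩, h3⟩
    rw [count_eq_card Q _ (hsufnd Q hQ), count_eq_card Q _ (hsufnd Q hQ)]
    have h1 := Finset.pred_card_le_card_erase (a := 2 * n + 1)
      (s := ((Q.filter fun p => decide (p.1 = Quant.all)).map Prod.snd).toFinset)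
    have h2 := Finset.card_le_card_of_injOn
      (s := ((Q.filter fun p => decide (p.1 = Quant.all)).map Prod.snd).toFinset.erase (2 * n + 1))
      (t := ((Q.filter fun p => decide (p.1 = Quant.ex)).map Prod.snd).toFinset)
      (fun y => y + 1)
      (by
        intro y hy
        rw [Finset.mem_coe, Finset.mem_erase, hfs] at hy
        rw [Finset.mem_coe, hfs]
        exact hkey Q hQ y hy.2 hy.1)
      (by intro a _ b _ h; simpa using h)
    omega
  apply hfalse
  intro g
  -- reduce to the winning set
  have hvarsfin : (Φ'.pfx.map Prod.snd).toFinset =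
      (Finset.Icc 2 (2 * n + 1)).filter fun v => C v = none := by
    ext v
    simp only [List.mem_toFinset, Finset.mem_filter, Finset.mem_Icc, ← (hperm.map _).mem_iff]
    rw [hP, inst_vars, List.mem_filter]
    have := mem_modVars n v
    simp only [QBC.vars, modQBC] at this
    rw [this]
    simp
  have heval := evalQ_iff Φ'.pfx Φ'.matrix g
    (∑ v ∈ (Finset.Icc 2 (2 * n + 1)).filter (fun v => ¬ C v = none), b3 ((C v).getD false)
      - (n : ZMod 3)) hnd (by
    intro g' _
    rw [hmat]
    show modMatrix n 0 (override C g') ↔ _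
    unfold modMatrix
    rw [not_iff_not, Nat.zero_add, sum_pairs n (fun v => boolVal (override C g' v)),
      ← List.sum_toFinset _ hnd, hvarsfin]
    have e : ∀ a b : ℕ, a % 3 = b % 3 ↔ (a : ZMod 3) = (b : ZMod 3) := by
      intro a b
      exact (ZMod.natCast_eq_natCast_iff' a b 3).symm
    rw [e, Nat.cast_sum, ← sub_eq_zero, ← Finset.sum_filter_add_sum_filter_not _ (fun v => C v = none)]
    have e1 : ∑ v ∈ (Finset.Icc 2 (2 * n + 1)).filter (fun v => C v = none),
        ((boolVal (override C g' v) : ℕ) : ZMod 3) =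
        ∑ v ∈ (Finset.Icc 2 (2 * n + 1)).filter (fun v => C v = none), b3 (g' v) := by
      apply Finset.sum_congr rfl
      intro v hv
      rw [Finset.mem_filter] at hv
      rw [b3_cast, override, hv.2]; rfl
    have e2 : ∑ v ∈ (Finset.Icc 2 (2 * n + 1)).filter (fun v => ¬ C v = none),
        ((boolVal (override C g' v) : ℕ) : ZMod 3) =
        ∑ v ∈ (Finset.Icc 2 (2 * n + 1)).filter (fun v => ¬ C v = none),
          b3 ((C v).getD false) := by
      apply Finset.sum_congr rfl
      intro v hv
      rw [Finset.mem_filter] at hv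
      rw [b3_cast, override]
      obtain ⟨b, hb⟩ := Option.ne_none_iff_exists'.1 hv.2
      rw [hb]; rfl
    rw [e1, e2]
    constructor
    · intro h; rw [← h]; ring
    · intro h; rw [← h]; ring)
  rw [heval]
  rcases winSet_or _ hsuf with h | ⟨h1, -⟩
  · exact h _
  exfalso
  by_cases hA : ∃ l, w < l ∧ C l ≠ none
  · -- both missing variables are existential
    obtain ⟨l, hl, hCl⟩ := hA
    have hl2 := hle l hCl
    have hcnt := h1 _ (List.suffix_refl _)
    rw [count_eq_card _ _ hnd, count_eq_card _ _ hnd] at hcnt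
    set E := ((Φ'.pfx.filter fun p => decide (p.1 = Quant.ex)).map Prod.snd).toFinset with hE
    set U := ((Φ'.pfx.filter fun p => decide (p.1 = Quant.all)).map Prod.snd).toFinset with hU
    have hpos := Finset.pred_card_le_card_erase (a := 2 * n + 1) (s := U)
    have huE : u ∈ E := by
      rw [hE, hfs, hmem]
      exact ⟨hu, by omega, hCu, Or.inr ⟨rfl, Or.inr ⟨l, by omega, hCl⟩⟩⟩
    have hwE : w ∈ E.erase u := by
      rw [Finset.mem_erase, hE, hfs, hmem]
      exact ⟨by omega, by omega, by omega, hCw, Or.inr ⟨rfl, Or.inr ⟨l, by omega, hCl⟩⟩⟩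
    have c1 := Finset.card_erase_add_one huE
    have c2 := Finset.card_erase_add_one hwE
    have h2 := Finset.card_le_card_of_injOn (s := U.erase (2 * n + 1)) (t := (E.erase u).erase w)
      (fun y => y + 1)
      (by
        intro y hy
        rw [Finset.mem_coe, Finset.mem_erase, hU, hfs] at hy
        rw [Finset.mem_coe, Finset.mem_erase, Finset.mem_erase, hE, hfs]
        have hy' := (hmem _ _).1 hy.2
        simp at hy'
        have : l ≤ y := by
          by_contra hh
          exact hCl (hy'.2.2.2.2 l (by omega))
        exact ⟨by show y + 1 ≠ w; omega, by show y + 1 ≠ u; omega, hkey _ (List.suffix_refl _) y hy.2 hy.1⟩)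
      (by intro a _ b _ h; simpa using h)
    omega
  · -- too many alternations
    push Not at hA
    have hlen := alt_length t _ _ hsuf h1 hpi
    rw [List.length_map, ← List.length_map (f := Prod.snd),
      ← List.toFinset_card_of_nodup hnd, hvarsfin] at hlen
    have hsub : Finset.Icc (2 * (n - (t + 1) / 2) + 2) (2 * n + 1) ∪ {w} ⊆
        (Finset.Icc 2 (2 * n + 1)).filter fun v => C v = none := by
      intro v hv
      simp only [Finset.mem_union, Finset.mem_Icc, Finset.mem_singleton] at hv
      simp only [Finset.mem_filter, Finset.mem_Icc]
      rcases hv with hv | rfl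
      · exact ⟨by omega, hA v (by omega)⟩
      · exact ⟨by omega, hCw⟩
    have hc := Finset.card_le_card hsub
    rw [Finset.card_union_of_disjoint (by simp; omega), Nat.card_Icc, Finset.card_singleton] at hc
    omega

/-! ### The existential halving strategy -/

/-- `h` agrees with `g` on the variables `2, …, 2i`. -/
def AgreesTo (g : ℕ → Bool) (i : ℕ) (h : ℕ → Bool) : Prop :=
  ∀ v, 2 ≤ v → v ≤ 2 * i → h v = g v

open Classical in
/-- Number of elements of `T` agreeing with `g` on the variables `2, …, 2i`. -/
noncomputable def agreeCount (T : Finset (ℕ → Bool)) (g : ℕ → Bool) (i : ℕ) : ℕ :=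
  (T.filter fun h => AgreesTo g i h).card

/-- The plays of the halving strategy. -/
def goodPlays (T : Finset (ℕ → Bool)) (N : ℕ) : Set (ℕ → Bool) :=
  {g | ∀ i ≤ N, agreeCount T g i * 2 ^ i ≤ T.card}

theorem agreeCount_congr (T : Finset (ℕ → Bool)) (g g' : ℕ → Bool) (i : ℕ)
    (h : ∀ v ≤ 2 * i, g v = g' v) : agreeCount T g i = agreeCount T g' i := by
  classical
  unfold agreeCount
  congr 1
  apply Finset.filter_congr
  intro f _
  constructor
  · intro hf v h1 h2; rw [← h v h2]; exact hf v h1 h2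
  · intro hf v h1 h2; rw [h v h2]; exact hf v h1 h2

theorem good_extend (T : Finset (ℕ → Bool)) (j : ℕ) (g : ℕ → Bool) (hg : g ∈ goodPlays T j)
    (d : ℕ) : ∃ g' ∈ goodPlays T (j + d), ∀ v < 2 * j + 2, g' v = g v := by
  classical
  induction d with
  | zero => exact ⟨g, hg, fun _ _ => rfl⟩
  | succ d ih =>
    obtain ⟨g', h1, h2⟩ := ih
    set x := 2 * (j + d + 1) with hx
    have hsum : agreeCount T (Function.update g' x true) (j + d + 1) +
        agreeCount T (Function.update g' x false) (j + d + 1) ≤ agreeCount T g' (j + d) := by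
      unfold agreeCount
      rw [← Finset.card_union_of_disjoint]
      · apply Finset.card_le_card
        intro f hf
        simp only [Finset.mem_union, Finset.mem_filter] at hf ⊢
        rcases hf with ⟨hf1, hf2⟩ | ⟨hf1, hf2⟩
        all_goals
          refine ⟨hf1, fun v hv1 hv2 => ?_⟩
          have := hf2 v hv1 (by omega)
          rwa [Function.update_of_ne (by omega)] at this
      · rw [Finset.disjoint_left]
        intro f hf1 hf2
        simp only [Finset.mem_filter] at hf1 hf2
        have a1 := hf1.2 x (by omega) (by omega)
        have a2 := hf2.2 x (by omega) (by omega)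
        simp at a1 a2
        rw [a1] at a2; simp at a2
    obtain ⟨b, hb⟩ : ∃ b, 2 * agreeCount T (Function.update g' x b) (j + d + 1) ≤
        agreeCount T g' (j + d) := by
      by_contra hcon
      push Not at hcon
      have c1 := hcon true
      have c2 := hcon false
      omega
    refine ⟨Function.update g' x b, ?_, ?_⟩
    · intro i hi
      rcases Nat.lt_or_ge i (j + d + 1) with hi' | hi'
      · rw [agreeCount_congr T _ g' i]
        · exact h1 i (by omega)
        · intro v hv; rw [Function.update_of_ne (by omega)]
      · have : i = j + d + 1 := by omega
        subst this
        have h3 := h1 (j + d) le_rfl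
        calc _ = 2 * agreeCount T (Function.update g' x b) (j + d + 1) * 2 ^ (j + d) := by ring
          _ ≤ agreeCount T g' (j + d) * 2 ^ (j + d) := Nat.mul_le_mul_right _ hb
          _ ≤ _ := h3
    · intro v hv
      rw [Function.update_of_ne (by omega)]; exact h2 v hv

theorem good_nonempty (T : Finset (ℕ → Bool)) (N : ℕ) : ∃ g, g ∈ goodPlays T N := by
  obtain ⟨g, hg, -⟩ := good_extend T 0 (fun _ => false) (by
    intro i hi
    have : i = 0 := by omega
    subst this
    unfold agreeCount
    classical
    simpa using Finset.card_filter_le _ _) N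
  rw [Nat.zero_add] at hg
  exact ⟨g, hg⟩

theorem good_branch (T : Finset (ℕ → Bool)) (N : ℕ) (g : ℕ → Bool) (hg : g ∈ goodPlays T N)
    (j : ℕ) (b : Bool) :
    ∃ g' ∈ goodPlays T N, (∀ v < 2 * j + 1, g' v = g v) ∧ g' (2 * j + 1) = b := by
  have h0 : ∀ i ≤ N, i ≤ j → agreeCount T (Function.update g (2 * j + 1) b) i * 2 ^ i ≤ T.card := by
    intro i hi hij
    rw [agreeCount_congr T _ g i]
    · exact hg i hi
    · intro v hv; rw [Function.update_of_ne (by omega)]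
  rcases Nat.lt_or_ge j N with hj | hj
  · obtain ⟨g', h1, h2⟩ := good_extend T j (Function.update g (2 * j + 1) b)
      (fun i hi => h0 i (by omega) hi) (N - j)
    rw [Nat.add_sub_cancel' hj.le] at h1
    refine ⟨g', h1, ?_, ?_⟩
    · intro v hv; rw [h2 v (by omega), Function.update_of_ne (by omega)]
    · rw [h2 _ (by omega)]; simp
  · refine ⟨_, fun i hi => h0 i hi (by omega), ?_, ?_⟩
    · intro v hv; rw [Function.update_of_ne (by omega)]
    · simp

theorem good_avoid (T : Finset (ℕ → Bool)) (N : ℕ) (hT : T.card < 2 ^ N) (g : ℕ → Bool)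
    (hg : g ∈ goodPlays T N) (h : ℕ → Bool) (hh : h ∈ T)
    (hag : ∀ v, 2 ≤ v → v ≤ 2 * N → h v = g v) : False := by
  classical
  have h1 := hg N le_rfl
  have h2 : 1 ≤ agreeCount T g N := by
    unfold agreeCount
    exact Finset.card_pos.2 ⟨h, Finset.mem_filter.2 ⟨hh, hag⟩⟩
  have := Nat.mul_le_mul_right (2 ^ N) h2
  omega

/-! ### Soundness -/

theorem sound_plays (n : ℕ) (H : Set PA) (L : List QUStep) (hL : IsQUProof (modQBC n) H L)
    (S : Set (ℕ → Bool))
    (hbr : ∀ g ∈ S, ∀ (j : ℕ) (b : Bool),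
      ∃ g' ∈ S, (∀ v < 2 * j + 1, g' v = g v) ∧ g' (2 * j + 1) = b)
    (hax : ∀ (i : ℕ) (C : PA), L[i]? = some (QUStep.ax C) → C ∈ H → ∀ g ∈ S, ¬ TotalExtends g C) :
    ∀ i C, stepClause? L i = some C → ∀ g ∈ S, ¬ TotalExtends g C := by
  intro i
  induction i using Nat.strong_induction_on with
  | _ i ih =>
    intro C hC g hg hext
    have hv := hL i
    unfold validStep at hv
    unfold stepClause? at hC
    rcases hLi : L[i]? with _ | st
    · rw [hLi] at hC; simp at hC
    rw [hLi] at hC hv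
    cases st with
    | ax D =>
      simp [QUStep.clause] at hC hv
      subst hC
      exact hax i _ hLi hv g hg hext
    | elim D s =>
      simp [QUStep.clause] at hC hv
      subst hC
      obtain ⟨hs, E, hE, y, b, hy, hDy, rfl, hpre⟩ := hv
      rw [mem_univVars] at hy
      have hy' := (mem_modPrefix n _ _).1 hy
      have hodd : y % 2 = 1 := by
        rcases Nat.mod_two_eq_zero_or_one y with h | h
        · have := hy'.2.2; rw [h] at this; simp at this
        · exact h
      obtain ⟨j, rfl⟩ : ∃ j, y = 2 * j + 1 := ⟨y / 2, by omega⟩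
      obtain ⟨g', hg', h1, h2⟩ := hbr g hg j b
      refine ih s hs _ hE g' hg' ?_
      intro v c hvc
      by_cases hvy : v = 2 * j + 1
      · subst hvy
        simp at hvc
        rw [h2, hvc]
      · rw [Function.update_of_ne hvy] at hvc
        have := (preceq_mod n _ _).1 (hpre v (by simp [hvc]))
        rw [h1 v (by omega)]
        exact hext v c hvc
    | res D s t x =>
      simp [QUStep.clause] at hC hv
      subst hC
      obtain ⟨hs, ht, α, hα, β, hβ, b, hb1, hb2, -, hu, hcomp⟩ := hv
      by_cases hgx : g x = b
      · refine ih s hs α hα g hg ?_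
        intro v c hvc
        by_cases hvx : v = x
        · subst hvx; rw [hb1] at hvc; simp at hvc; rw [hgx, hvc]
        · apply hext v c; rw [hu v hvx, hvc]; rfl
      · refine ih t ht β hβ g hg ?_
        intro v c hvc
        by_cases hvx : v = x
        · subst hvx; rw [hb2] at hvc; simp at hvc
          revert hgx hvc; cases g v <;> cases b <;> cases c <;> simp
        · -- the first clause may also be defined at this variable
          rcases hαv : α v with _ | c'
          · apply hext v c; rw [hu v hvx, hαv, hvc]; rfl
          · have e1 := hext v c' (by rw [hu v hvx, hαv]; rfl)
            rw [e1]; exact hcomp v hvx c' c hαv hvc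

theorem mod3_lower_bound (n t : ℕ) (ht : 2 ≤ t) (hn : (t + 1) / 2 ≤ n)
    (L : List QUStep)
    (hL : IsFalsityProof (modQBC n) (Hset (modQBC n) t) L) :
    2 ^ (n - (t + 1) / 2 - 1) ≤ {i | isSink L i}.ncard ∧
    2 ^ (n - (t + 1) / 2 - 1) ≤ L.length := by
  classical
  have hsub : {i | isSink L i} ⊆ ((Finset.range L.length : Finset ℕ) : Set ℕ) := by
    intro i hi; simpa using hi.1
  have hfin : {i | isSink L i}.Finite := (Finset.finite_toSet _).subset hsub
  have hlen : {i | isSink L i}.ncard ≤ L.length := by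
    have := Set.ncard_le_ncard hsub (Finset.finite_toSet _)
    rwa [Set.ncard_coe_finset, Finset.card_range] at this
  suffices h : 2 ^ (n - (t + 1) / 2 - 1) ≤ {i | isSink L i}.ncard from ⟨h, h.trans hlen⟩
  by_contra hlt
  push Not at hlt
  set N := n - (t + 1) / 2 with hN
  rw [Set.ncard_eq_toFinset_card _ hfin] at hlt
  let T : Finset (ℕ → Bool) := (hfin.toFinset ×ˢ (Finset.univ : Finset Bool)).image
    fun p => override ((stepClause? L p.1).getD emptyPA) (fun _ => p.2)
  have hT : T.card < 2 ^ N := by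
    have h1 : T.card ≤ hfin.toFinset.card * 2 := by
      refine Finset.card_image_le.trans ?_
      rw [Finset.card_product]; simp
    rcases Nat.eq_zero_or_pos N with h0 | h0
    · rw [h0] at hlt ⊢; simp at hlt ⊢; simp [hlt] at h1; simpa using h1
    · obtain ⟨M, hM⟩ : ∃ M, N = M + 1 := ⟨N - 1, by omega⟩
      rw [hM] at hlt ⊢
      rw [pow_succ]
      simp only [Nat.add_sub_cancel] at hlt
      omega
  obtain ⟨hproof, hlast⟩ := hL
  have hs := sound_plays n _ L hproof (goodPlays T N) (fun g hg j b => good_branch T N g hg j b)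
    (by
      intro i C hi hC g hg hext
      have hiL : i < L.length := by
        by_contra hh
        rw [List.getElem?_eq_none (by omega)] at hi; simp at hi
      have hsink : isSink L i := by
        refine ⟨hiL, fun j hj => ?_⟩
        unfold edge at hj
        rw [hi] at hj; exact hj
      have hcl : (stepClause? L i).getD emptyPA = C := by
        unfold stepClause?; rw [hi]; rfl
      have hmemT : ∀ b, override C (fun _ => b) ∈ T := by
        intro b
        refine Finset.mem_image.2 ⟨(i, b), ?_, ?_⟩
        · simp [hsink]
        · simp only [hcl]
      obtain ⟨b, hb⟩ : ∃ b, ∀ v, 2 ≤ v → v ≤ 2 * N → C v = none → g v = b := by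
        by_cases hex : ∃ v, 2 ≤ v ∧ v ≤ 2 * N ∧ C v = none
        · obtain ⟨v0, h1, h2, h3⟩ := hex
          refine ⟨g v0, fun v k1 k2 k3 => ?_⟩
          rcases lt_trichotomy v v0 with h | h | h
          · exact (missing_contra n t hn C hC v v0 k1 h h2 k3 h3).elim
          · rw [h]
          · exact (missing_contra n t hn C hC v0 v h1 h k2 h3 k3).elim
        · refine ⟨true, fun v k1 k2 k3 => (hex ⟨v, k1, k2, k3⟩).elim⟩
      refine good_avoid T N hT g hg _ (hmemT b) ?_
      intro v k1 k2
      unfold override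
      rcases hCv : C v with _ | c
      · simp [hb v k1 k2 hCv]
      · simp [hext v c hCv])
  obtain ⟨g, hg⟩ := good_nonempty T N
  refine hs (L.length - 1) emptyPA ?_ g hg ?_
  · unfold stepClause?
    rw [← List.getLast?_eq_getElem?]; exact hlast
  · intro v b hv; simp [emptyPA] at hv
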